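/- arXiv:1210.3896 — 2 statements merged into one kernel-verified Lean document; each statement's English description precedes it below -/
import Mathlib

section
/- For smooth real functions S^{ab} = S^{ba}, γ^a, θ on ℝⁿ and real numbers δ, λ, define the canonical pencil operator Δ_λ f = (1/2)(S^{ab}∂_a∂_b f + (∂_b S^{ba})∂_a f + (2λ+δ−1)γ^a∂_a f + λ(∂_aγ^a)f + λ(λ+δ−1)θ f) acting on smooth functions f. Then the pencil is self-adjoint: for every λ ∈ ℝ and all compactly supported smooth functions f, g on ℝⁿ, ∫_{ℝⁿ}(Δ_λ f)·g dx = ∫_{ℝⁿ} f·(Δ_{1−λ−δ} g) dx. -/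
open MeasureTheory Real

/-- Partial derivative of a function on ℝⁿ in the direction of the `a`-th coordinate. -/
noncomputable def pd {n : ℕ} (a : Fin n) (f : (Fin n → ℝ) → ℝ) : (Fin n → ℝ) → ℝ :=
  fun x => fderiv ℝ f x (Pi.single a 1)

/-- The canonical pencil operator of weight `δ` with data `(S, γ, θ)`, evaluated
at pencil parameter `lam`:
`Δ_λ f = (1/2)(S^{ab}∂_a∂_b f + (∂_b S^{ba})∂_a f + (2λ+δ−1)γ^a∂_a f
  + λ(∂_aγ^a)f + λ(λ+δ−1)θ f)`. -/
noncomputable def pencil {n : ℕ} (δ lam : ℝ) (S : Fin n → Fin n → (Fin n → ℝ) → ℝ)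
    (γ : Fin n → (Fin n → ℝ) → ℝ) (θ : (Fin n → ℝ) → ℝ)
    (f : (Fin n → ℝ) → ℝ) (x : Fin n → ℝ) : ℝ :=
  (1/2) * (∑ a, ∑ b, S a b x * pd a (pd b f) x
    + ∑ a, (∑ b, pd b (S b a) x) * pd a f x
    + (2*lam + δ - 1) * ∑ a, γ a x * pd a f x
    + lam * (∑ a, pd a (γ a) x) * f x
    + lam * (lam + δ - 1) * θ x * f x)

theorem ContDiff.pd {n : ℕ} {f : (Fin n → ℝ) → ℝ} (hf : ContDiff ℝ (⊤ : ℕ∞) f) (a : Fin n) :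
    ContDiff ℝ (⊤ : ℕ∞) (pd a f) :=
  (hf.fderiv_right (m := (⊤ : ℕ∞)) (by simp)).clm_apply contDiff_const

theorem HasCompactSupport.pd {n : ℕ} {f : (Fin n → ℝ) → ℝ} (hf : HasCompactSupport f)
    (a : Fin n) : HasCompactSupport (pd a f) :=
  hf.fderiv_apply (𝕜 := ℝ) (Pi.single a 1)

section pd

variable {n : ℕ} {f g : (Fin n → ℝ) → ℝ} {x : Fin n → ℝ}

theorem pd_mul (hf : DifferentiableAt ℝ f x) (hg : DifferentiableAt ℝ g x) (a : Fin n) :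
    pd a (fun y => f y * g y) x = pd a f x * g x + f x * pd a g x := by
  simp only [pd, fderiv_fun_mul hf hg]
  simp
  ring

theorem pd_add (hf : DifferentiableAt ℝ f x) (hg : DifferentiableAt ℝ g x) (a : Fin n) :
    pd a (fun y => f y + g y) x = pd a f x + pd a g x := by
  simp [pd, fderiv_fun_add hf hg]

theorem pd_sub (hf : DifferentiableAt ℝ f x) (hg : DifferentiableAt ℝ g x) (a : Fin n) :
    pd a (fun y => f y - g y) x = pd a f x - pd a g x := by
  simp [pd, fderiv_fun_sub hf hg]

theorem pd_const_mul (hf : DifferentiableAt ℝ f x) (c : ℝ) (a : Fin n) :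
    pd a (fun y => c * f y) x = c * pd a f x := by
  simp [pd, fderiv_const_mul hf]

theorem pd_sum {ι : Type*} {s : Finset ι} {F : ι → (Fin n → ℝ) → ℝ}
    (hF : ∀ i ∈ s, DifferentiableAt ℝ (F i) x) (a : Fin n) :
    pd a (fun y => ∑ i ∈ s, F i y) x = ∑ i ∈ s, pd a (F i) x := by
  simp [pd, fderiv_fun_sum hF]

/-- The integral of a partial derivative of a compactly supported function vanishes. -/
theorem integral_pd_eq_zero (hf : ContDiff ℝ (⊤ : ℕ∞) f) (hfc : HasCompactSupport f)
    (a : Fin n) : ∫ x, pd a f x = 0 := by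
  have hint : Integrable f := hf.continuous.integrable_of_hasCompactSupport hfc
  have hint' : Integrable (pd a f) :=
    (hf.pd a).continuous.integrable_of_hasCompactSupport (hfc.pd a)
  simpa [pd] using integral_mul_fderiv_eq_neg_fderiv_mul_of_integrable
    (f := fun _ => (1 : ℝ)) (g := f) (v := Pi.single a 1) (μ := volume)
    (by simp) (by simp only [one_mul]; exact hint') (by simpa using hint)
    (fun _ _ => differentiableAt_const _)
    (fun _ _ => (hf.differentiable (by simp)).differentiableAt)

end pd

section pencil

variable {n : ℕ} {S : Fin n → Fin n → (Fin n → ℝ) → ℝ} {γ : Fin n → (Fin n → ℝ) → ℝ}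
  {θ f g : (Fin n → ℝ) → ℝ}

theorem continuous_pencil (δ lam : ℝ) (hS : ∀ a b, ContDiff ℝ (⊤ : ℕ∞) (S a b))
    (hγ : ∀ a, ContDiff ℝ (⊤ : ℕ∞) (γ a)) (hθ : ContDiff ℝ (⊤ : ℕ∞) θ)
    (hf : ContDiff ℝ (⊤ : ℕ∞) f) : Continuous (pencil δ lam S γ θ f) := by
  have hSc := fun a b => (hS a b).continuous
  have hSc' := fun a b c => ((hS a b).pd c).continuous
  have hγc := fun a => (hγ a).continuous
  have hγc' := fun a b => ((hγ a).pd b).continuous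
  have hθc := hθ.continuous
  have hfc := hf.continuous
  have hfc' := fun a => (hf.pd a).continuous
  have hfc'' := fun a b => ((hf.pd a).pd b).continuous
  unfold pencil
  fun_prop

/-- The `a`-th component of the vector field whose divergence measures the failure of the pencil
to be pointwise self-adjoint. -/
noncomputable def pencilFlux (δ lam : ℝ) (S : Fin n → Fin n → (Fin n → ℝ) → ℝ)
    (γ : Fin n → (Fin n → ℝ) → ℝ) (f g : (Fin n → ℝ) → ℝ) (a : Fin n) (x : Fin n → ℝ) : ℝ :=
  (1/2) * (∑ b, S a b x * (pd b f x * g x - f x * pd b g x)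
    + (2*lam + δ - 1) * (γ a x * (f x * g x)))

theorem contDiff_pencilFlux (δ lam : ℝ) (hS : ∀ a b, ContDiff ℝ (⊤ : ℕ∞) (S a b))
    (hγ : ∀ a, ContDiff ℝ (⊤ : ℕ∞) (γ a)) (hf : ContDiff ℝ (⊤ : ℕ∞) f)
    (hg : ContDiff ℝ (⊤ : ℕ∞) g) (a : Fin n) :
    ContDiff ℝ (⊤ : ℕ∞) (pencilFlux δ lam S γ f g a) := by
  have hf' := hf.pd
  have hg' := hg.pd
  unfold pencilFlux
  fun_prop

theorem hasCompactSupport_pencilFlux (δ lam : ℝ) (hf : HasCompactSupport f) (a : Fin n) :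
    HasCompactSupport (pencilFlux δ lam S γ f g a) := by
  refine hf.mono' fun x hx => ?_
  contrapose! hx
  have hpd (b : Fin n) : pd b f x = 0 :=
    image_eq_zero_of_notMem_tsupport fun h =>
      hx (tsupport_fderiv_apply_subset ℝ (Pi.single b 1) h)
  simp [pencilFlux, hpd, image_eq_zero_of_notMem_tsupport hx]

theorem pd_pencilFlux (δ lam : ℝ) (hS : ∀ a b, ContDiff ℝ (⊤ : ℕ∞) (S a b))
    (hγ : ∀ a, ContDiff ℝ (⊤ : ℕ∞) (γ a)) (hf : ContDiff ℝ (⊤ : ℕ∞) f)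
    (hg : ContDiff ℝ (⊤ : ℕ∞) g) (a : Fin n) (x : Fin n → ℝ) :
    pd a (pencilFlux δ lam S γ f g a) x =
      (1/2) * (∑ b, (pd a (S a b) x * (pd b f x * g x - f x * pd b g x)
          + S a b x * (pd a (pd b f) x * g x + pd b f x * pd a g x
            - (pd a f x * pd b g x + f x * pd a (pd b g) x)))
        + (2*lam + δ - 1) * (pd a (γ a) x * (f x * g x)
          + γ a x * (pd a f x * g x + f x * pd a g x))) := by
  have hS' := fun a b => ((hS a b).differentiable (by simp)).differentiableAt (x := x)
  have hγ' := fun a => ((hγ a).differentiable (by simp)).differentiableAt (x := x)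
  have hf₀ := (hf.differentiable (by simp)).differentiableAt (x := x)
  have hg₀ := (hg.differentiable (by simp)).differentiableAt (x := x)
  have hf₁ := fun b => ((hf.pd b).differentiable (by simp)).differentiableAt (x := x)
  have hg₁ := fun b => ((hg.pd b).differentiable (by simp)).differentiableAt (x := x)
  unfold pencilFlux
  rw [pd_const_mul (by fun_prop), pd_add (by fun_prop) (by fun_prop),
    pd_sum (fun _ _ => by fun_prop), pd_const_mul (by fun_prop),
    pd_mul (hγ' a) (by fun_prop), pd_mul hf₀ hg₀]
  congr 2
  refine Finset.sum_congr rfl fun b _ => ?_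
  rw [pd_mul (hS' a b) (by fun_prop), pd_sub (by fun_prop) (by fun_prop),
    pd_mul (hf₁ b) hg₀, pd_mul hf₀ (hg₁ b)]

/-- Green's identity for the pencil. -/
theorem pencil_mul_eq_mul_pencil_add_sum_pd (δ lam : ℝ)
    (hS : ∀ a b, ContDiff ℝ (⊤ : ℕ∞) (S a b)) (hSsymm : ∀ a b, S a b = S b a)
    (hγ : ∀ a, ContDiff ℝ (⊤ : ℕ∞) (γ a)) (hf : ContDiff ℝ (⊤ : ℕ∞) f)
    (hg : ContDiff ℝ (⊤ : ℕ∞) g) (x : Fin n → ℝ) :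
    pencil δ lam S γ θ f x * g x = f x * pencil δ (1 - lam - δ) S γ θ g x
      + ∑ a, pd a (pencilFlux δ lam S γ f g a) x := by
  have hcross : ∑ a, ∑ b, S a b x * (pd b f x * pd a g x)
      = ∑ a, ∑ b, S a b x * (pd a f x * pd b g x) := by
    rw [Finset.sum_comm]
    exact Finset.sum_congr rfl fun a _ => Finset.sum_congr rfl fun b _ => by rw [hSsymm b a]
  have hdiv (h : (Fin n → ℝ) → ℝ) : ∑ a, (∑ b, pd b (S b a) x) * pd a h x
      = ∑ a, ∑ b, pd a (S a b) x * pd b h x := by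
    simp only [Finset.sum_mul]
    exact Finset.sum_comm
  have hsum : ∑ a, pd a (pencilFlux δ lam S γ f g a) x =
      (1/2) * ((∑ a, ∑ b, pd a (S a b) x * pd b f x) * g x
        - f x * (∑ a, ∑ b, pd a (S a b) x * pd b g x)
        + (∑ a, ∑ b, S a b x * pd a (pd b f) x) * g x
        + ∑ a, ∑ b, S a b x * (pd b f x * pd a g x)
        - ∑ a, ∑ b, S a b x * (pd a f x * pd b g x)
        - f x * (∑ a, ∑ b, S a b x * pd a (pd b g) x)
        + (2*lam + δ - 1) * ((∑ a, pd a (γ a) x) * (f x * g x)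
          + (∑ a, γ a x * pd a f x) * g x + f x * ∑ a, γ a x * pd a g x)) := by
    simp only [pd_pencilFlux δ lam hS hγ hf hg, Finset.sum_mul, Finset.mul_sum,
      ← Finset.sum_add_distrib, ← Finset.sum_sub_distrib]
    refine Finset.sum_congr rfl fun a _ => ?_
    simp only [mul_add, Finset.mul_sum]
    congr 1
    · exact Finset.sum_congr rfl fun b _ => by ring
    · ring
  rw [hsum, hcross]
  simp only [pencil, hdiv]
  ring

end pencil

/-- the canonical pencil is self-adjoint:
`∫ (Δ_λ f) g dx = ∫ f (Δ_{1−λ−δ} g) dx`. -/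
theorem statement2 (n : ℕ) (δ : ℝ)
    (S : Fin n → Fin n → (Fin n → ℝ) → ℝ) (γ : Fin n → (Fin n → ℝ) → ℝ)
    (θ : (Fin n → ℝ) → ℝ)
    (hS : ∀ a b, ContDiff ℝ (⊤ : ℕ∞) (S a b)) (hSsymm : ∀ a b, S a b = S b a)
    (hγ : ∀ a, ContDiff ℝ (⊤ : ℕ∞) (γ a)) (hθ : ContDiff ℝ (⊤ : ℕ∞) θ) :
    ∀ lam : ℝ, ∀ f g : (Fin n → ℝ) → ℝ,
      ContDiff ℝ (⊤ : ℕ∞) f → HasCompactSupport f → ContDiff ℝ (⊤ : ℕ∞) g → HasCompactSupport g →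
      ∫ x, pencil δ lam S γ θ f x * g x = ∫ x, f x * pencil δ (1 - lam - δ) S γ θ g x := by
  intro lam f g hf hfc hg _
  have hflux (a : Fin n) : Integrable (pd a (pencilFlux δ lam S γ f g a)) :=
    ((contDiff_pencilFlux δ lam hS hγ hf hg a).pd a).continuous.integrable_of_hasCompactSupport
      ((hasCompactSupport_pencilFlux δ lam hfc a).pd a)
  have hint : Integrable (fun x => f x * pencil δ (1 - lam - δ) S γ θ g x) :=
    (hf.continuous.mul (continuous_pencil δ _ hS hγ hθ hg)).integrable_of_hasCompactSupport
      hfc.mul_right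
  simp only [pencil_mul_eq_mul_pencil_add_sum_pd δ lam hS hSsymm hγ hf hg]
  rw [integral_add hint (integrable_finsetSum _ fun a _ => hflux a),
    integral_finsetSum _ fun a _ => hflux a, Finset.sum_eq_zero, add_zero]
  exact fun a _ => integral_pd_eq_zero (contDiff_pencilFlux δ lam hS hγ hf hg a)
    (hasCompactSupport_pencilFlux δ lam hfc a) a
end

section
/- Let δ ∈ ℝ with δ ≠ 1, and let X^a, X⁰ be smooth real functions on ℝⁿ. Consider the family of first-order operators D_λ f = X^a∂_a f + λX⁰·f (λ ∈ ℝ) on smooth functions, and define the divergence div(X^a, X⁰) = ∂_a X^a + (δ−1)X⁰. Then D_λ decomposes uniquely as D_λ = V_λ + L_λ where V_λ f = λ·V·f is a vertical family (first-order coefficients zero) and L_λ f = Y^a∂_a f + λ·W·f is a family with div(Y^a, W) = 0; explicitly V = X⁰ + (∂_a X^a)/(δ−1), Y^a = X^a, W = (∂_a X^a)/(1−δ), so that the divergence-free part is the generalized Lie derivative L_λ f = X^a∂_a f + (λ/(1−δ))(∂_a X^a)f. Moreover the vertical part carries the full divergence: div(0, V) = div(X^a, X⁰). -/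
open MeasureTheory Real

theorem pd_const {n : ℕ} (a : Fin n) (c : ℝ) (x : Fin n → ℝ) : pd a (fun _ => c) x = 0 := by
  simp [pd]

theorem pd_coord {n : ℕ} (a b : Fin n) (x : Fin n → ℝ) :
    pd a (fun y => y b) x = if a = b then 1 else 0 := by
  have h : HasFDerivAt (fun y : Fin n → ℝ => y b)
      (ContinuousLinearMap.proj (R := ℝ) (φ := fun _ : Fin n => ℝ) b) x :=
    (ContinuousLinearMap.proj (R := ℝ) (φ := fun _ : Fin n => ℝ) b).hasFDerivAt
  simp [pd, h.fderiv, Pi.single_apply, eq_comm]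

/-- a derivation of weight `δ ≠ 1` of the algebra of densities, given in
coordinates by the family `D_λ f = X^a∂_a f + λX⁰f`, decomposes uniquely into a vertical
family and a divergence-free family (the generalized Lie derivative), and the vertical
part carries the full divergence `div(X^a, X⁰) = ∂_a X^a + (δ−1)X⁰`. -/
theorem statement16 (n : ℕ) (δ : ℝ) (hδ : δ ≠ 1)
    (X : Fin n → (Fin n → ℝ) → ℝ) (X0 : (Fin n → ℝ) → ℝ)
    (hX : ∀ a, ContDiff ℝ (⊤ : ℕ∞) (X a)) (hX0 : ContDiff ℝ (⊤ : ℕ∞) X0)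
    (V W : (Fin n → ℝ) → ℝ) (Y : Fin n → (Fin n → ℝ) → ℝ)
    (hV : ∀ x, V x = X0 x + (∑ a, pd a (X a) x) / (δ - 1))
    (hY : ∀ a x, Y a x = X a x)
    (hW : ∀ x, W x = (∑ a, pd a (X a) x) / (1 - δ)) :
    -- decomposition D_λ = V_λ + L_λ:
    (∀ lam : ℝ, ∀ f : (Fin n → ℝ) → ℝ, ∀ x,
      ∑ a, X a x * pd a f x + lam * X0 x * f x
        = lam * V x * f x + (∑ a, Y a x * pd a f x + lam * W x * f x))
    ∧
    -- the family (Y, W) is divergence-free: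
    (∀ x, ∑ a, pd a (Y a) x + (δ - 1) * W x = 0)
    ∧
    -- the generalized Lie derivative form of the divergence-free part:
    (∀ lam : ℝ, ∀ f : (Fin n → ℝ) → ℝ, ∀ x,
      ∑ a, Y a x * pd a f x + lam * W x * f x
        = ∑ a, X a x * pd a f x + (lam / (1 - δ)) * (∑ a, pd a (X a) x) * f x)
    ∧
    -- the vertical part carries the full divergence: div(0, V) = div(X, X⁰):
    (∀ x, ∑ a, pd a (fun _ => (0:ℝ)) x + (δ - 1) * V x
        = ∑ a, pd a (X a) x + (δ - 1) * X0 x)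
    ∧
    -- uniqueness of the decomposition:
    (∀ (V' W' : (Fin n → ℝ) → ℝ) (Y' : Fin n → (Fin n → ℝ) → ℝ),
      (∀ lam : ℝ, ∀ f : (Fin n → ℝ) → ℝ, ∀ x,
        ∑ a, X a x * pd a f x + lam * X0 x * f x
          = lam * V' x * f x + (∑ a, Y' a x * pd a f x + lam * W' x * f x)) →
      (∀ x, ∑ a, pd a (Y' a) x + (δ - 1) * W' x = 0) →
      (∀ x, V' x = V x) ∧ (∀ a x, Y' a x = Y a x) ∧ (∀ x, W' x = W x)) := by
  have h1 : δ - 1 ≠ 0 := sub_ne_zero.mpr hδ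
  have h2 : 1 - δ ≠ 0 := sub_ne_zero.mpr hδ.symm
  obtain rfl : Y = X := funext fun a => funext fun x => hY a x
  have hVW : ∀ x, V x + W x = X0 x := fun x => by
    rw [hV, hW, ← neg_sub δ 1, div_neg]
    ring
  have hdiv : ∀ x, ∑ a, pd a (Y a) x + (δ - 1) * W x = 0 := fun x => by
    rw [hW]
    field_simp
    ring
  refine ⟨fun lam f x => ?_, hdiv, fun lam f x => ?_, fun x => ?_, fun V' W' Y' hdec hdiv' => ?_⟩
  · rw [← hVW]
    ring
  · rw [hW]
    ring
  · simp only [pd_const, Finset.sum_const_zero, zero_add]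
    linear_combination (δ - 1) * hVW x - hdiv x
  · obtain rfl : Y' = Y := by
      funext b x
      simpa [pd_coord] using (hdec 0 (fun y => y b) x).symm
    have hW' : ∀ x, W' x = W x := fun x =>
      mul_left_cancel₀ h1 (by linear_combination hdiv' x - hdiv x)
    refine ⟨fun x => ?_, fun _ _ => rfl, hW'⟩
    have h := hdec 1 (fun _ => 1) x
    simp only [pd_const, mul_zero, Finset.sum_const_zero] at h
    linear_combination -h - hVW x - hW' x
end
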